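/- Let g be a continuous Riemannian metric on ℝ² with finite total area A, and suppose c1·Id ≤ g(x) ≤ c2·Id as quadratic forms for all x in a closed Euclidean ball B̄_R centered at the origin, where c2 ≥ c1 > 0. Let C1 > 0. Then there exists a constant δ2 > 0 such that every piecewise C¹ simple closed curve γ with image contained in B̄_R satisfying the planar isoperimetric inequality 4π·|Ω_γ| ≤ L_e(γ)² (where Ω_γ is the union of the bounded connected components of the complement of the image of γ, |Ω_γ| its Lebesgue area, and L_e(γ) its Euclidean length) and satisfying I(γ) < C1, has A_in(γ) > δ2 and A_out(γ) > δ2. -/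

import Mathlib

open MeasureTheory Set Real

noncomputable section

abbrev E2 := EuclideanSpace ℝ (Fin 2)

/-- The quadratic form associated to a 2×2 matrix. -/
def qf (M : Matrix (Fin 2) (Fin 2) ℝ) (v : E2) : ℝ :=
  ∑ i, ∑ j, M i j * v i * v j

/-- A continuous Riemannian metric on ℝ²: a continuous field of symmetric
positive definite 2×2 matrices. -/
def IsRiemMetric (g : E2 → Matrix (Fin 2) (Fin 2) ℝ) : Prop :=
  Continuous g ∧ (∀ x, (g x).IsSymm) ∧ ∀ x, ∀ v : E2, v ≠ 0 → 0 < qf (g x) v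

/-- A piecewise C¹ curve in ℝ²: continuous on `[a,b]` and differentiable
outside a finite set. -/
structure PC1Curve where
  a : ℝ
  b : ℝ
  hab : a < b
  toFun : ℝ → E2
  cont : ContinuousOn toFun (Icc a b)
  sm : ∃ s : Finset ℝ, ∀ t ∈ Icc a b, t ∉ s → DifferentiableAt ℝ toFun t

def PC1Curve.IsSimpleClosed (c : PC1Curve) : Prop :=
  c.toFun c.a = c.toFun c.b ∧ InjOn c.toFun (Ico c.a c.b)

def PC1Curve.image (c : PC1Curve) : Set E2 := c.toFun '' (Icc c.a c.b)

/-- Union of the bounded connected components of the complement of the image. -/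
def PC1Curve.interiorRegion (c : PC1Curve) : Set E2 :=
  {x | x ∉ c.image ∧ Bornology.IsBounded (connectedComponentIn c.imageᶜ x)}

/-- Length of a curve with respect to the metric `g`. -/
def Lg (g : E2 → Matrix (Fin 2) (Fin 2) ℝ) (c : PC1Curve) : ℝ :=
  ∫ t in c.a..c.b, Real.sqrt (qf (g (c.toFun t)) (deriv c.toFun t))

/-- Euclidean length of a curve. -/
def Le (c : PC1Curve) : ℝ :=
  ∫ t in c.a..c.b, ‖deriv c.toFun t‖

/-- Area density `√(det g)` of the metric `g`. -/
def areaDensity (g : E2 → Matrix (Fin 2) (Fin 2) ℝ) (x : E2) : ℝ :=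
  Real.sqrt ((g x).det)

/-- Total area of ℝ² with respect to `g`. -/
def totalArea (g : E2 → Matrix (Fin 2) (Fin 2) ℝ) : ℝ :=
  ∫ x, areaDensity g x

/-- Area inside a closed curve with respect to `g`. -/
def Ain (g : E2 → Matrix (Fin 2) (Fin 2) ℝ) (c : PC1Curve) : ℝ :=
  ∫ x in c.interiorRegion, areaDensity g x

/-- Area outside a closed curve with respect to `g`. -/
def Aout (g : E2 → Matrix (Fin 2) (Fin 2) ℝ) (c : PC1Curve) : ℝ :=
  totalArea g - Ain g c

/-- The isoperimetric ratio `I(γ)`. -/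
def Iratio (g : E2 → Matrix (Fin 2) (Fin 2) ℝ) (c : PC1Curve) : ℝ :=
  Lg g c * (1 / Ain g c + 1 / Aout g c)

/-- The isoperimetric constant `I_g`: infimum of `I(γ)` over piecewise C¹
simple closed curves. -/
def Ig (g : E2 → Matrix (Fin 2) (Fin 2) ℝ) : ℝ :=
  sInf {r | ∃ c : PC1Curve, c.IsSimpleClosed ∧ Iratio g c = r}


/-- The closed curve `ζ` on `[a, b]` has winding number zero about `z`, in the sense that
`ζ - z` admits a continuous logarithm which closes up. -/
def HasClosedLog (ζ : ℝ → ℂ) (a b : ℝ) (z : ℂ) : Prop :=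
  ∃ F : ℝ → ℂ, ContinuousOn F (Icc a b) ∧ F a = F b ∧
    ∀ t ∈ Icc a b, ζ t - z = Complex.exp (F t)

theorem HasClosedLog.of_norm_lt {ζ : ℝ → ℂ} {a b : ℝ} {z w : ℂ} (h : HasClosedLog ζ a b z)
    (hζ : ContinuousOn ζ (Icc a b)) (hab : ζ a = ζ b)
    (hw : ∀ t ∈ Icc a b, ‖w - z‖ < ‖ζ t - z‖) : HasClosedLog ζ a b w := by
  obtain ⟨F, hF, hFab, hexp⟩ := h
  have hne : ∀ t ∈ Icc a b, ζ t - z ≠ 0 := fun t ht => by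
    rw [hexp t ht]; exact Complex.exp_ne_zero _
  have hslit : ∀ t ∈ Icc a b, 1 + (z - w) / (ζ t - z) ∈ Complex.slitPlane := fun t ht => by
    apply Complex.mem_slitPlane_of_norm_lt_one
    rw [norm_div, div_lt_one (norm_pos_iff.2 (hne t ht)), norm_sub_rev]
    exact hw t ht
  refine ⟨fun t => F t + Complex.log (1 + (z - w) / (ζ t - z)), ?_, ?_, fun t ht => ?_⟩
  · exact hF.add (ContinuousOn.clog (continuousOn_const.add
      (continuousOn_const.div (hζ.sub continuousOn_const) hne)) hslit)
  · simp only [hFab, hab]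
  · rw [Complex.exp_add, Complex.exp_log (Complex.slitPlane_ne_zero (hslit t ht)), ← hexp t ht]
    have := hne t ht
    field_simp
    ring

theorem hasClosedLog_of_norm_lt_norm {ζ : ℝ → ℂ} {a b : ℝ} {z : ℂ}
    (hζ : ContinuousOn ζ (Icc a b)) (hab : ζ a = ζ b) (hz0 : z ≠ 0)
    (hz : ∀ t ∈ Icc a b, ‖ζ t‖ < ‖z‖) : HasClosedLog ζ a b z := by
  have hslit : ∀ t ∈ Icc a b, 1 + -(ζ t / z) ∈ Complex.slitPlane := fun t ht => by
    apply Complex.mem_slitPlane_of_norm_lt_one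
    rw [norm_neg, norm_div, div_lt_one (norm_pos_iff.2 hz0)]
    exact hz t ht
  refine ⟨fun t => Complex.log (-z) + Complex.log (1 + -(ζ t / z)), ?_, ?_, fun t ht => ?_⟩
  · exact continuousOn_const.add (ContinuousOn.clog (continuousOn_const.add
      (hζ.div_const z).neg) hslit)
  · simp only [hab]
  · rw [Complex.exp_add, Complex.exp_log (Complex.slitPlane_ne_zero (hslit t ht)),
      Complex.exp_log (neg_ne_zero.2 hz0)]
    field_simp
    ring

/-- A continuous function that vanishes at `t₀` only and has positive sine just after `t₀`
is positive after `t₀`. -/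
theorem pos_of_sin_pos_right {θ : ℝ → ℝ} {t₀ b : ℝ} (htb : t₀ < b)
    (hθ : ContinuousOn θ (Icc t₀ b)) (h0 : θ t₀ = 0)
    (hne : ∀ t ∈ Ioc t₀ b, θ t ≠ 0) {ε : ℝ} (hε : 0 < ε)
    (hsin : ∀ t ∈ Ioc t₀ b, t < t₀ + ε → 0 < sin (θ t)) : 0 < θ b := by
  by_contra! hb
  have hbneg : θ b < 0 := lt_of_le_of_ne hb (hne b ⟨htb, le_rfl⟩)
  have hcw := hθ t₀ ⟨le_rfl, htb.le⟩
  obtain ⟨δ, hδ, hclose⟩ := Metric.continuousWithinAt_iff.1 hcw π pi_pos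
  obtain ⟨t, ht₀, ht⟩ := exists_between (lt_min (lt_min (lt_add_of_pos_right t₀ hε)
    (lt_add_of_pos_right t₀ hδ)) htb)
  have ht1 : t < t₀ + ε := ht.trans_le ((min_le_left _ _).trans (min_le_left _ _))
  have ht2 : t < t₀ + δ := ht.trans_le ((min_le_left _ _).trans (min_le_right _ _))
  have ht3 : t < b := ht.trans_le (min_le_right _ _)
  have hs := hsin t ⟨ht₀, ht3.le⟩ ht1
  have hd := hclose (x := t) ⟨ht₀.le, ht3.le⟩ (by
    rw [Real.dist_eq, abs_of_pos (by linarith)]; linarith)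
  rw [h0, Real.dist_eq, sub_zero, abs_lt] at hd
  have hpos : 0 < θ t := by
    by_contra! hle
    exact absurd (sin_nonpos_of_nonpos_of_neg_pi_le hle hd.1.le) (not_le.2 hs)
  obtain ⟨s, hs, hs0⟩ := intermediate_value_Icc' ht3.le
    (hθ.mono (Icc_subset_Icc_left ht₀.le)) ⟨hbneg.le, hpos.le⟩
  exact hne s ⟨ht₀.trans_le hs.1, hs.2⟩ hs0

theorem neg_of_sin_neg_left {θ : ℝ → ℝ} {a t₀ : ℝ} (hat : a < t₀)
    (hθ : ContinuousOn θ (Icc a t₀)) (h0 : θ t₀ = 0)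
    (hne : ∀ t ∈ Ico a t₀, θ t ≠ 0) {ε : ℝ} (hε : 0 < ε)
    (hsin : ∀ t ∈ Ico a t₀, t₀ - ε < t → sin (θ t) < 0) : θ a < 0 := by
  have hpos := pos_of_sin_pos_right (θ := fun t => -θ (-t)) (t₀ := -t₀) (b := -a)
    (neg_lt_neg hat)
    ((hθ.comp continuous_neg.continuousOn fun t ht => ⟨by linarith [ht.2], by linarith [ht.1]⟩).neg)
    (by simp [h0])
    (fun t ht => neg_ne_zero.2 (hne (-t) ⟨by linarith [ht.2], by linarith [ht.1]⟩)) hε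
    (fun t ht hlt => by
      rw [sin_neg]
      exact neg_pos.2 (hsin (-t) ⟨by linarith [ht.2], by linarith [ht.1]⟩ (by linarith)))
  simpa using hpos

/-- A closed curve crossing the segment `[p - i h u, p + i h u]` only once, transversally at `p`,
cannot have winding number zero about both endpoints. -/
theorem not_hasClosedLog_of_crossing {ζ : ℝ → ℂ} {a b t₀ h ε : ℝ} {p u : ℂ}
    (ht₀ : t₀ ∈ Ioo a b) (hh : 0 < h) (hu : u ≠ 0) (hp : ζ t₀ = p) (hε : 0 < ε)
    (hright : ∀ t ∈ Ioc t₀ b, t < t₀ + ε → 0 < ((ζ t - p) / u).re)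
    (hleft : ∀ t ∈ Ico a t₀, t₀ - ε < t → ((ζ t - p) / u).re < 0)
    (hseg : ∀ t ∈ Icc a b, t ≠ t₀ → ((ζ t - p) / u).re = 0 → h < |((ζ t - p) / u).im|)
    (hplus : HasClosedLog ζ a b (p + h * Complex.I * u))
    (hminus : HasClosedLog ζ a b (p - h * Complex.I * u)) : False := by
  obtain ⟨F, hF, hFab, hFexp⟩ := hplus
  obtain ⟨G, hG, hGab, hGexp⟩ := hminus
  have ht₀' : t₀ ∈ Icc a b := ⟨ht₀.1.le, ht₀.2.le⟩
  set D : ℝ → ℂ := fun t => (F t - G t) - (F t₀ - G t₀) with hD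
  have hDc : ContinuousOn D (Icc a b) := (hF.sub hG).sub continuousOn_const
  have hexp₀ : Complex.exp (F t₀ - G t₀) = -1 := by
    rw [Complex.exp_sub, ← hFexp t₀ ht₀', ← hGexp t₀ ht₀', hp]
    have : (h : ℂ) ≠ 0 := by exact_mod_cast hh.ne'
    have := Complex.I_ne_zero
    field_simp
    ring_nf
  have hexp : ∀ t ∈ Icc a b, Complex.exp (D t) * ((ζ t - p) / u + h * Complex.I)
      = h * Complex.I - (ζ t - p) / u := fun t ht => by
    have hne := Complex.exp_ne_zero (G t)
    have hnum : ζ t - (p + h * Complex.I * u) = -(u * (h * Complex.I - (ζ t - p) / u)) := by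
      field_simp
      ring
    have hden : ζ t - (p - h * Complex.I * u) = u * ((ζ t - p) / u + h * Complex.I) := by
      field_simp
      ring
    rw [hD, Complex.exp_sub, hexp₀, Complex.exp_sub, ← hFexp t ht, ← hGexp t ht, hnum, hden]
    rw [← hGexp t ht, hden] at hne
    have hne' := right_ne_zero_of_mul hne
    generalize (ζ t - p) / u = w at hne'
    field_simp
  have hreal : ∀ t ∈ Icc a b,
      Real.exp (D t).re * sin (D t).im * Complex.normSq ((ζ t - p) / u + h * Complex.I)
        = 2 * h * ((ζ t - p) / u).re := fun t ht => by
    have h1 := congrArg (fun z => (z * (starRingEnd ℂ) ((ζ t - p) / u + h * Complex.I)).im)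
      (hexp t ht)
    simp only [mul_assoc, Complex.mul_conj] at h1
    rw [Complex.im_mul_ofReal, Complex.exp_im] at h1
    rw [h1]
    generalize (ζ t - p) / u = w
    simp
    ring
  have hnorm : ∀ t ∈ Icc a b, 0 < Complex.normSq ((ζ t - p) / u + h * Complex.I) := fun t ht => by
    rw [Complex.normSq_pos]
    intro h0
    have h1 := hexp t ht
    rw [h0, mul_zero] at h1
    have h2 : (2 * h : ℂ) * Complex.I = 0 := by linear_combination h0 - h1
    have h3 : (h : ℂ) ≠ 0 := by exact_mod_cast hh.ne'
    simp [h3] at h2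
  have hθc : ContinuousOn (fun t => (D t).im) (Icc a b) :=
    Complex.continuous_im.comp_continuousOn hDc
  have hθ0 : (D t₀).im = 0 := by simp [hD]
  have hne : ∀ t ∈ Icc a b, t ≠ t₀ → (D t).im ≠ 0 := fun t ht htt h0 => by
    have hr := hreal t ht
    rw [h0, sin_zero, mul_zero, zero_mul] at hr
    have hre : ((ζ t - p) / u).re = 0 := by
      rcases mul_eq_zero.1 hr.symm with h | h
      · linarith
      · exact h
    have him := congrArg Complex.im (hexp t ht)
    have hE : (Complex.exp (D t)).im = 0 := by rw [Complex.exp_im, h0, sin_zero, mul_zero]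
    have hE' : 0 < (Complex.exp (D t)).re := by
      rw [Complex.exp_re, h0, cos_zero, mul_one]; exact Real.exp_pos _
    have hlt := hseg t ht htt hre
    rw [Complex.mul_im, hE] at him
    simp only [Complex.add_im, Complex.sub_im, Complex.mul_im, Complex.ofReal_re, Complex.I_im,
      Complex.ofReal_im, Complex.I_re, mul_one, mul_zero, zero_mul, add_zero] at him
    set e := (Complex.exp (D t)).re
    set y := ((ζ t - p) / u).im
    rcases lt_abs.1 hlt with h' | h' <;> nlinarith
  have hsin : ∀ t ∈ Icc a b, (0 < ((ζ t - p) / u).re → 0 < sin (D t).im) ∧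
      (((ζ t - p) / u).re < 0 → sin (D t).im < 0) := fun t ht => by
    have hr := hreal t ht
    have hn := hnorm t ht
    have he := Real.exp_pos (D t).re
    have hen := mul_pos he hn
    constructor <;> intro hx <;> by_contra! hs
    · nlinarith [mul_pos hh hx, mul_nonneg hen.le (neg_nonneg.2 hs)]
    · nlinarith [mul_pos hh (neg_pos.2 hx), mul_nonneg hen.le hs]
  have hb := pos_of_sin_pos_right (θ := fun t => (D t).im) ht₀.2
    (hθc.mono (Icc_subset_Icc_left ht₀.1.le)) hθ0
    (fun t ht => hne t ⟨ht₀.1.le.trans ht.1.le, ht.2⟩ ht.1.ne') hε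
    (fun t ht hlt => (hsin t ⟨ht₀.1.le.trans ht.1.le, ht.2⟩).1 (hright t ht hlt))
  have ha := neg_of_sin_neg_left (θ := fun t => (D t).im) ht₀.1
    (hθc.mono (Icc_subset_Icc_right ht₀.2.le)) hθ0
    (fun t ht => hne t ⟨ht.1, ht.2.le.trans ht₀.2.le⟩ ht.2.ne) hε
    (fun t ht hlt => (hsin t ⟨ht.1, ht.2.le.trans ht₀.2.le⟩).2 (hleft t ht hlt))
  have hab : D a = D b := by simp only [hD, hFab, hGab]
  simp only [hab] at ha hb
  exact lt_asymm ha hb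

/-- The isometric identification of the Euclidean plane with `ℂ`. -/
def toComplex : E2 ≃ₗᵢ[ℝ] ℂ := Complex.orthonormalBasisOneI.repr.symm

namespace PC1Curve

variable (c : PC1Curve)

theorem isCompact_image : IsCompact c.image := isCompact_Icc.image_of_continuousOn c.cont

theorem continuousOn_toComplex : ContinuousOn (fun t => toComplex (c.toFun t)) (Icc c.a c.b) :=
  toComplex.continuous.comp_continuousOn c.cont

variable {c}

theorem hasClosedLog_of_unbounded (hc : c.IsSimpleClosed) {x : E2} (hx : x ∉ c.image)
    (hunb : ¬ Bornology.IsBounded (connectedComponentIn c.imageᶜ x)) :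
    HasClosedLog (fun t => toComplex (c.toFun t)) c.a c.b (toComplex x) := by
  set P : E2 → Prop := fun y => HasClosedLog (fun t => toComplex (c.toFun t)) c.a c.b (toComplex y)
    with hP
  have hab : toComplex (c.toFun c.a) = toComplex (c.toFun c.b) := by rw [hc.1]
  have hstep : ∀ y z, (∀ q ∈ c.image, dist z y < dist q y) → P y → P z := fun y z hd hy => by
    refine HasClosedLog.of_norm_lt hy c.continuousOn_toComplex hab fun t ht => ?_
    simpa [← map_sub, dist_eq_norm] using hd _ (mem_image_of_mem _ ht)
  have hopen : IsOpen c.imageᶜ := c.isCompact_image.isClosed.isOpen_compl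
  have hdist : ∀ y ∈ c.imageᶜ, ∃ r > 0, ∀ q ∈ c.image, r ≤ dist q y := fun y hy => by
    obtain ⟨r, hr, hball⟩ := Metric.isOpen_iff.1 hopen y hy
    exact ⟨r, hr, fun q hq => not_lt.1 fun hlt => hball (Metric.mem_ball.2 hlt) hq⟩
  have hU : IsOpen {y | y ∈ c.imageᶜ ∧ P y} := by
    refine Metric.isOpen_iff.2 fun y hy => ?_
    obtain ⟨r, hr, hq⟩ := hdist y hy.1
    refine ⟨r, hr, fun z hz => ⟨fun hzi => ?_, ?_⟩⟩
    · exact absurd (hq z hzi) (not_le.2 hz)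
    · exact hstep y z (fun q hqi => (Metric.mem_ball.1 hz).trans_le (hq q hqi)) hy.2
  have hV : IsOpen {y | y ∈ c.imageᶜ ∧ ¬ P y} := by
    refine Metric.isOpen_iff.2 fun y hy => ?_
    obtain ⟨r, hr, hq⟩ := hdist y hy.1
    refine ⟨r / 2, half_pos hr, fun z hz => ⟨fun hzi => ?_, fun hPz => hy.2 ?_⟩⟩
    · linarith [hq z hzi, Metric.mem_ball.1 hz]
    · refine hstep z y (fun q hqi => ?_) hPz
      have := dist_triangle q z y
      rw [dist_comm y z]
      linarith [hq q hqi, Metric.mem_ball.1 hz]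
  obtain ⟨M, hM⟩ := c.isCompact_image.isBounded.exists_norm_le
  obtain ⟨y, hy, hyM⟩ : ∃ y ∈ connectedComponentIn c.imageᶜ x, max M 0 < ‖y‖ := by
    by_contra! hle
    exact hunb (isBounded_iff_forall_norm_le.2 ⟨_, hle⟩)
  have hyP : P y := by
    refine hasClosedLog_of_norm_lt_norm c.continuousOn_toComplex hab ?_ fun t ht => ?_
    · have : 0 < ‖y‖ := (le_max_right _ _).trans_lt hyM
      simpa using norm_pos_iff.1 this
    · simpa using (hM _ (mem_image_of_mem _ ht)).trans_lt ((le_max_left _ _).trans_lt hyM)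
  by_contra hxP
  obtain ⟨z, -, hz1, hz2⟩ := (isPreconnected_connectedComponentIn (F := c.imageᶜ) (x := x))
    _ _ hU hV
    (fun z hz => by
      have := connectedComponentIn_subset _ _ hz
      by_cases h : P z
      · exact Or.inl ⟨this, h⟩
      · exact Or.inr ⟨this, h⟩)
    ⟨y, hy, connectedComponentIn_subset _ _ hy, hyP⟩
    ⟨x, mem_connectedComponentIn hx, hx, hxP⟩
  exact hz2.2 hz1.2

theorem exists_deriv_ne_zero (hc : c.IsSimpleClosed) :
    ∃ t ∈ Ioo c.a c.b, DifferentiableAt ℝ c.toFun t ∧ deriv c.toFun t ≠ 0 := by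
  obtain ⟨s, hs⟩ := c.sm
  by_contra! hzero
  obtain ⟨t, ht, hts⟩ := ((Ioo_infinite c.hab).sdiff s.finite_toSet).nonempty
  obtain ⟨r, hr, hball⟩ := Metric.isOpen_iff.1
    (isOpen_Ioo.sdiff s.finite_toSet.isClosed : IsOpen (Ioo c.a c.b \ (s : Set ℝ))) t ⟨ht, hts⟩
  have hdiff : ∀ u ∈ Metric.ball t r, DifferentiableAt ℝ c.toFun u := fun u hu =>
    hs u (Ioo_subset_Icc_self (hball hu).1) (hball hu).2
  have ht' : t ∈ Metric.ball t r := Metric.mem_ball_self hr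
  have hu' : t + r / 2 ∈ Metric.ball t r := by
    rw [Metric.mem_ball, Real.dist_eq, add_sub_cancel_left, abs_of_pos (half_pos hr)]
    linarith
  have heq := Metric.isOpen_ball.is_const_of_deriv_eq_zero
    (convex_ball t r).isPreconnected (fun u hu => (hdiff u hu).differentiableWithinAt)
    (fun u hu => hzero u (hball hu).1 (hdiff u hu)) ht' hu'
  have := hc.2 (Ioo_subset_Ico_self (hball ht').1) (Ioo_subset_Ico_self (hball hu').1) heq
  linarith

/-- Separation part of the Jordan curve theorem for piecewise `C¹` curves. -/
theorem interiorRegion_nonempty (hc : c.IsSimpleClosed) : c.interiorRegion.Nonempty := by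
  obtain ⟨t₀, ht₀, hdiff, hderiv⟩ := exists_deriv_ne_zero hc
  set ζ : ℝ → ℂ := fun t => toComplex (c.toFun t) with hζ
  set p := ζ t₀ with hp
  set u := toComplex (deriv c.toFun t₀) with hu
  have hu0 : u ≠ 0 := by simpa [hu] using hderiv
  have hζd : HasDerivAt ζ u t₀ :=
    (toComplex.toContinuousLinearEquiv.toContinuousLinearMap.hasFDerivAt).comp_hasDerivAt t₀
      hdiff.hasDerivAt
  have hwd : HasDerivAt (fun t => ((ζ t - p) / u).re) 1 t₀ := by
    have h1 := (hζd.sub_const p).div_const u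
    rw [div_self hu0] at h1
    exact (Complex.reCLM.hasFDerivAt).comp_hasDerivAt t₀ h1
  obtain ⟨ε, hε, hsign⟩ : ∃ ε > 0, ∀ t, |t - t₀| < ε →
      |((ζ t - p) / u).re - (t - t₀)| ≤ 1 / 2 * |t - t₀| := by
    have := (hasDerivAt_iff_isLittleO.1 hwd).def (c := 1 / 2) (by norm_num)
    obtain ⟨ε, hε, h⟩ := Metric.eventually_nhds_iff.1 this
    refine ⟨ε, hε, fun t ht => ?_⟩
    simpa [hp] using h (y := t) (by rwa [Real.dist_eq])
  have hright : ∀ t, t₀ < t → t < t₀ + ε → 0 < ((ζ t - p) / u).re := fun t h1 h2 => by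
    have h0 : |t - t₀| = t - t₀ := abs_of_pos (sub_pos.2 h1)
    have := hsign t (by rw [h0]; linarith)
    rw [h0] at this
    linarith [(abs_le.1 this).1]
  have hleft : ∀ t, t < t₀ → t₀ - ε < t → ((ζ t - p) / u).re < 0 := fun t h1 h2 => by
    have h0 : |t - t₀| = -(t - t₀) := abs_of_neg (sub_neg.2 h1)
    have := hsign t (by rw [h0]; linarith)
    rw [h0] at this
    linarith [(abs_le.1 this).2]
  have hinj : ∀ t ∈ Icc c.a c.b, t ≠ t₀ → ζ t - p ≠ 0 := fun t ht hne h0 => by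
    have heq : c.toFun t = c.toFun t₀ := toComplex.injective (sub_eq_zero.1 h0)
    rcases ht.2.lt_or_eq with hlt | rfl
    · exact hne (hc.2 ⟨ht.1, hlt⟩ (Ioo_subset_Ico_self ht₀) heq)
    · rw [← hc.1] at heq
      exact ht₀.1.ne (hc.2 ⟨le_rfl, c.hab⟩ (Ioo_subset_Ico_self ht₀) heq)
  obtain ⟨h, hh, hfar⟩ : ∃ h > 0, ∀ t ∈ Icc c.a c.b, ε ≤ |t - t₀| → h < ‖(ζ t - p) / u‖ := by
    have hK : IsCompact (Icc c.a c.b ∩ {t | ε ≤ |t - t₀|}) :=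
      isCompact_Icc.inter_right (isClosed_le continuous_const (by fun_prop))
    have hcont : ContinuousOn (fun t => ‖(ζ t - p) / u‖) (Icc c.a c.b ∩ {t | ε ≤ |t - t₀|}) :=
      ((c.continuousOn_toComplex.sub continuousOn_const).div_const u).norm.mono inter_subset_left
    rcases (Icc c.a c.b ∩ {t | ε ≤ |t - t₀|}).eq_empty_or_nonempty with he | hne
    · refine ⟨1, one_pos, fun t ht hle => ?_⟩
      exact absurd (he ▸ ⟨ht, hle⟩ : t ∈ (∅ : Set ℝ)) (notMem_empty t)
    · obtain ⟨m, hm, hmin⟩ := hK.exists_isMinOn hne hcont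
      have hmt : m ≠ t₀ := by
        rintro rfl
        have := hm.2
        simp at this
        linarith
      have hpos : 0 < ‖(ζ m - p) / u‖ := norm_pos_iff.2 (div_ne_zero (hinj m hm.1 hmt) hu0)
      exact ⟨_, half_pos hpos, fun t ht hle => (half_lt_self hpos).trans_le (hmin ⟨ht, hle⟩)⟩
  have hseg : ∀ t ∈ Icc c.a c.b, t ≠ t₀ → ((ζ t - p) / u).re = 0 → h < |((ζ t - p) / u).im| :=
    fun t ht hne hre => by
      have hle : ε ≤ |t - t₀| := by
        by_contra! hlt
        rw [abs_lt] at hlt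
        rcases hne.lt_or_gt with h1 | h1
        · exact (hleft t h1 (by linarith)).ne hre
        · exact (hright t h1 (by linarith)).ne' hre
      rw [Complex.abs_im_eq_norm.2 hre]
      exact hfar t ht hle
  have hoff : ∀ s : ℝ, |s| = h → toComplex.symm (p + s * Complex.I * u) ∉ c.image := by
    rintro s hs ⟨t, ht, heq⟩
    have hval : (ζ t - p) / u = s * Complex.I := by
      rw [hζ]
      simp only [heq, LinearIsometryEquiv.apply_symm_apply, add_sub_cancel_left]
      field_simp
    rcases eq_or_ne t t₀ with rfl | hne
    · simp only [← hp, sub_self, zero_div] at hval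
      have : s = 0 := by simpa using hval.symm
      simp [this] at hs
      exact hh.ne hs
    · have := hseg t ht hne (by simp [hval])
      simp [hval, hs] at this
  have hlog : ∀ s : ℝ, |s| = h → toComplex.symm (p + s * Complex.I * u) ∉ c.interiorRegion →
      HasClosedLog ζ c.a c.b (p + s * Complex.I * u) := fun s hs hnot => by
    have := hasClosedLog_of_unbounded hc (hoff s hs) fun hb => hnot ⟨hoff s hs, hb⟩
    simpa using this
  by_contra hempty
  rw [not_nonempty_iff_eq_empty] at hempty
  refine not_hasClosedLog_of_crossing ht₀ hh hu0 rfl hε (fun t ht => hright t ht.1)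
    (fun t ht => hleft t ht.2) hseg (hlog h (abs_of_pos hh) (by simp [hempty])) ?_
  have := hlog (-h) (by rw [abs_neg, abs_of_pos hh]) (by simp [hempty])
  simpa [sub_eq_add_neg] using this

theorem isOpen_interiorRegion (c : PC1Curve) : IsOpen c.interiorRegion := by
  have hopen : IsOpen c.imageᶜ := c.isCompact_image.isClosed.isOpen_compl
  refine isOpen_iff_mem_nhds.2 fun x hx => ?_
  filter_upwards [hopen.connectedComponentIn.mem_nhds (mem_connectedComponentIn hx.1)] with y hy
  exact ⟨connectedComponentIn_subset _ _ hy, connectedComponentIn_eq hy ▸ hx.2⟩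

theorem interiorRegion_subset_closedBall {R : ℝ}
    (hR : c.image ⊆ Metric.closedBall (0 : E2) R) (hR0 : 0 ≤ R) :
    c.interiorRegion ⊆ Metric.closedBall (0 : E2) R := by
  intro x hx
  by_contra hxR
  have hxR' : R < ‖x‖ := by simpa using hxR
  set ray : Set E2 := (fun s : ℝ => s • x) '' Ici 1
  have hray : ray ⊆ connectedComponentIn c.imageᶜ x := by
    refine IsPreconnected.subset_connectedComponentIn
      (isPreconnected_Ici.image _ (by fun_prop)) ⟨1, self_mem_Ici, one_smul _ _⟩ ?_
    rintro _ ⟨s, hs, rfl⟩ hmem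
    have hs1 : (1 : ℝ) ≤ s := hs
    have := hR hmem
    rw [mem_closedBall_zero_iff, norm_smul, Real.norm_of_nonneg (by linarith)] at this
    nlinarith [norm_nonneg x]
  obtain ⟨M, hM⟩ := (hx.2.subset hray).exists_norm_le
  have hx0 : 0 < ‖x‖ := hR0.trans_lt hxR'
  have hs1 : (1 : ℝ) ≤ 1 + |M| / ‖x‖ := by
    have : 0 ≤ |M| / ‖x‖ := by positivity
    linarith
  have := hM _ ⟨1 + |M| / ‖x‖, hs1, rfl⟩
  simp only [norm_smul] at this
  rw [Real.norm_of_nonneg (by linarith), add_mul, one_mul, div_mul_cancel₀ _ hx0.ne'] at this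
  linarith [le_abs_self M]

theorem volume_interiorRegion_pos (hc : c.IsSimpleClosed) : 0 < volume c.interiorRegion :=
  c.isOpen_interiorRegion.measure_pos _ (interiorRegion_nonempty hc)

end PC1Curve

theorem det_pos_of_qf_pos {M : Matrix (Fin 2) (Fin 2) ℝ} (hM : M.IsSymm)
    (hpos : ∀ v : E2, v ≠ 0 → 0 < qf M v) : 0 < M.det := by
  have h00 : 0 < M 0 0 := by
    have := hpos !₂[1, 0] (fun h => by simpa using congrArg (fun v : E2 => v 0) h)
    simpa [qf, Fin.sum_univ_two] using this
  have hdet := hpos !₂[-M 0 1, M 0 0] (fun h => h00.ne' (by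
    simpa using congrArg (fun v : E2 => v 1) h))
  have h10 : M 1 0 = M 0 1 := hM.apply 0 1
  simp only [qf, Fin.sum_univ_two, h10] at hdet
  rw [Matrix.det_fin_two, h10]
  simp at hdet
  nlinarith

theorem sqrt_det_le_of_qf_le {M : Matrix (Fin 2) (Fin 2) ℝ} {C : ℝ} (hM : M.IsSymm)
    (hC : ∀ v : E2, 0 ≤ qf M v ∧ qf M v ≤ C * ‖v‖ ^ 2) : √M.det ≤ C := by
  have h0 := hC !₂[1, 0]
  have h1 := hC !₂[0, 1]
  simp [qf, Fin.sum_univ_two, EuclideanSpace.norm_sq_eq] at h0 h1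
  have h10 : M 1 0 = M 0 1 := hM.apply 0 1
  refine Real.sqrt_le_iff.2 ⟨h0.1.trans h0.2, ?_⟩
  rw [Matrix.det_fin_two, h10]
  nlinarith [mul_le_mul h0.2 h1.2 h1.1 (h0.1.trans h0.2), sq_nonneg (M 0 1)]

theorem setIntegral_areaDensity_pos {g : E2 → Matrix (Fin 2) (Fin 2) ℝ} (hg : IsRiemMetric g)
    (hA : Integrable (areaDensity g)) {s : Set E2}
    (hpos : 0 < volume s) : 0 < ∫ x in s, areaDensity g x := by
  have hnn : 0 ≤ᵐ[volume.restrict s] areaDensity g := ae_of_all _ fun x => sqrt_nonneg _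
  rw [setIntegral_pos_iff_support_of_nonneg_ae hnn hA.integrableOn]
  have hsupp : Function.support (areaDensity g) = univ := eq_univ_of_forall fun x =>
    (sqrt_pos.2 (det_pos_of_qf_pos (hg.2.1 x) (hg.2.2 x))).ne'
  rwa [hsupp, univ_inter]

theorem volume_compl_closedBall_pos (R : ℝ) :
    0 < volume (Metric.closedBall (0 : E2) R)ᶜ := by
  refine Metric.isClosed_closedBall.isOpen_compl.measure_pos _ ?_
  obtain ⟨x, hx⟩ := NormedSpace.exists_lt_norm ℝ E2 R
  exact ⟨x, by simpa using hx⟩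

theorem sqrt_mul_Le_le_Lg {g : E2 → Matrix (Fin 2) (Fin 2) ℝ} (hg : Continuous g) {c1 c2 : ℝ}
    {c : PC1Curve} (hbound : ∀ x ∈ c.image, ∀ v : E2,
      c1 * ‖v‖ ^ 2 ≤ qf (g x) v ∧ qf (g x) v ≤ c2 * ‖v‖ ^ 2)
    (hint : IntervalIntegrable (fun t => ‖deriv c.toFun t‖) volume c.a c.b) :
    √c1 * Le c ≤ Lg g c := by
  have hsqrt : ∀ (k : ℝ) (v : E2), √(k * ‖v‖ ^ 2) = √k * ‖v‖ := fun k v => by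
    rw [sqrt_mul' _ (sq_nonneg _), sqrt_sq (norm_nonneg _)]
  have hmeas : AEStronglyMeasurable (fun t => √(qf (g (c.toFun t)) (deriv c.toFun t)))
      (volume.restrict (uIoc c.a c.b)) := by
    have hentry : ∀ i j, AEMeasurable (fun t => g (c.toFun t) i j)
        (volume.restrict (uIoc c.a c.b)) := fun i j => by
      rw [uIoc_of_le c.hab.le]
      exact (((hg.matrix_elem i j).comp_continuousOn c.cont).mono
        Ioc_subset_Icc_self).aemeasurable measurableSet_Ioc
    have hcoord : ∀ i, Measurable fun t => deriv c.toFun t i := fun i =>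
      (EuclideanSpace.proj (𝕜 := ℝ) i).continuous.measurable.comp (measurable_deriv c.toFun)
    refine (AEMeasurable.sqrt ?_).aestronglyMeasurable
    simp only [qf, Fin.sum_univ_two]
    exact (((((hentry 0 0).mul (hcoord 0).aemeasurable).mul (hcoord 0).aemeasurable).add
      (((hentry 0 1).mul (hcoord 0).aemeasurable).mul (hcoord 1).aemeasurable)).add
      ((((hentry 1 0).mul (hcoord 1).aemeasurable).mul (hcoord 0).aemeasurable).add
      (((hentry 1 1).mul (hcoord 1).aemeasurable).mul (hcoord 1).aemeasurable)))
  have hintg : IntervalIntegrable (fun t => √(qf (g (c.toFun t)) (deriv c.toFun t)))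
      volume c.a c.b := by
    refine (hint.const_mul √c2).mono_fun hmeas ?_
    refine (ae_restrict_iff' measurableSet_uIoc).2 (ae_of_all _ fun t ht => ?_)
    rw [uIoc_of_le c.hab.le] at ht
    simp only
    rw [Real.norm_of_nonneg (sqrt_nonneg _), Real.norm_of_nonneg (by positivity), ← hsqrt]
    exact sqrt_le_sqrt (hbound _ (mem_image_of_mem _ (Ioc_subset_Icc_self ht)) _).2
  rw [Le, Lg, ← intervalIntegral.integral_const_mul]
  refine intervalIntegral.integral_mono_on c.hab.le (hint.const_mul _) hintg fun t ht => ?_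
  rw [← hsqrt]
  exact sqrt_le_sqrt (hbound _ (mem_image_of_mem _ ht) _).1

/-- **Corollary 8.** If `c1·Id ≤ g ≤ c2·Id` on a closed ball `B̄_R`, then for any `C1 > 0`
there is `δ2 > 0` such that every piecewise C¹ simple closed curve in `B̄_R` satisfying
the planar isoperimetric inequality and `I(γ) < C1` has `A_in(γ) > δ2` and
`A_out(γ) > δ2`. -/
theorem area_lower_bound_of_small_ratio
    (g : E2 → Matrix (Fin 2) (Fin 2) ℝ) (hg : IsRiemMetric g)
    (hA : Integrable (areaDensity g))
    (R c1 c2 : ℝ) (hR : 0 < R) (hc1 : 0 < c1) (hc12 : c1 ≤ c2)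
    (hbound : ∀ x ∈ Metric.closedBall (0 : E2) R, ∀ v : E2,
      c1 * ‖v‖ ^ 2 ≤ qf (g x) v ∧ qf (g x) v ≤ c2 * ‖v‖ ^ 2)
    (C1 : ℝ) (hC1 : 0 < C1) :
    ∃ δ2 : ℝ, 0 < δ2 ∧
      ∀ c : PC1Curve, c.IsSimpleClosed →
        c.image ⊆ Metric.closedBall (0 : E2) R →
        4 * Real.pi * (volume c.interiorRegion).toReal ≤ (Le c) ^ 2 →
        Iratio g c < C1 →
        δ2 < Ain g c ∧ δ2 < Aout g c := by
  have hc2 : 0 < c2 := hc1.trans_le hc12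
  have hε := setIntegral_areaDensity_pos hg hA (volume_compl_closedBall_pos R)
  set ε := ∫ x in (Metric.closedBall (0 : E2) R)ᶜ, areaDensity g x
  have hK : 0 < 4 * π * c1 / (c2 * C1 ^ 2) := by positivity
  refine ⟨min (4 * π * c1 / (c2 * C1 ^ 2) / 2) (ε / 2),
    lt_min (half_pos hK) (half_pos hε), fun c hc himg hiso hI => ?_⟩
  have hΩ := PC1Curve.interiorRegion_subset_closedBall himg hR.le
  have hΩm := c.isOpen_interiorRegion.measurableSet
  have hΩpos := PC1Curve.volume_interiorRegion_pos hc
  have hΩfin : volume c.interiorRegion < ⊤ :=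
    (measure_mono hΩ).trans_lt measure_closedBall_lt_top
  have hV : 0 < (volume c.interiorRegion).toReal := ENNReal.toReal_pos hΩpos.ne' hΩfin.ne
  have hAin : 0 < Ain g c := setIntegral_areaDensity_pos hg hA hΩpos
  have hAinle : Ain g c ≤ c2 * (volume c.interiorRegion).toReal := by
    refine (le_abs_self _).trans (norm_setIntegral_le_of_norm_le_const (f := areaDensity g) hΩfin fun x hx => ?_)
    rw [areaDensity, Real.norm_of_nonneg (sqrt_nonneg _)]
    exact sqrt_det_le_of_qf_le (hg.2.1 x) fun v =>
      ⟨le_trans (by positivity) (hbound x (hΩ hx) v).1, (hbound x (hΩ hx) v).2⟩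
  have hAout : ε ≤ Aout g c := by
    have hsplit := integral_add_compl hΩm hA
    have hmono : ε ≤ ∫ x in c.interiorRegionᶜ, areaDensity g x :=
      setIntegral_mono_set hA.integrableOn (ae_of_all _ fun x => sqrt_nonneg _)
        (compl_subset_compl.2 hΩ).eventuallyLE
    simp only [Aout, totalArea, Ain]
    linarith
  have hAoutpos := hε.trans_le hAout
  have hLe : 0 < Le c := by
    have hnn : 0 ≤ Le c := intervalIntegral.integral_nonneg c.hab.le fun t _ => norm_nonneg _
    refine hnn.lt_of_ne' fun h0 => ?_
    rw [h0] at hiso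
    have : 0 < 4 * π * (volume c.interiorRegion).toReal := by positivity
    linarith
  have hLg := sqrt_mul_Le_le_Lg hg.1 (fun x hx => hbound x (himg hx))
    (intervalIntegral.intervalIntegrable_of_integral_ne_zero hLe.ne')
  refine ⟨?_, by linarith [min_le_right (4 * π * c1 / (c2 * C1 ^ 2) / 2) (ε / 2)]⟩
  have hLgpos : 0 < Lg g c := (mul_pos (sqrt_pos.2 hc1) hLe).trans_le hLg
  have hLgC : Lg g c < C1 * Ain g c := by
    rw [← div_lt_iff₀ hAin]
    refine lt_of_le_of_lt ?_ hI
    rw [Iratio, mul_add, mul_one_div]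
    have : 0 < Lg g c * (1 / Aout g c) := by positivity
    linarith
  have hsq : c1 * Le c ^ 2 ≤ Lg g c ^ 2 := by
    have := pow_le_pow_left₀ (by positivity) hLg 2
    rwa [mul_pow, sq_sqrt hc1.le] at this
  have hsq' : Lg g c ^ 2 < (C1 * Ain g c) ^ 2 := pow_lt_pow_left₀ hLgC hLgpos.le two_ne_zero
  have hlow : 4 * π * c1 / (c2 * C1 ^ 2) < Ain g c := by
    rw [div_lt_iff₀ (by positivity)]
    have h1 : 4 * π * c1 * Ain g c ≤ 4 * π * c1 * (c2 * (volume c.interiorRegion).toReal) :=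
      mul_le_mul_of_nonneg_left hAinle (by positivity)
    have h2 : c2 * (c1 * (4 * π * (volume c.interiorRegion).toReal)) ≤ c2 * (c1 * Le c ^ 2) := by
      gcongr
    have h3 : c2 * (c1 * Le c ^ 2) < c2 * (C1 * Ain g c) ^ 2 :=
      mul_lt_mul_of_pos_left (hsq.trans_lt hsq') hc2
    refine lt_of_mul_lt_mul_right (a := Ain g c) ?_ hAin.le
    linarith
  linarith [min_le_left (4 * π * c1 / (c2 * C1 ^ 2) / 2) (ε / 2)]
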